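/- arXiv:2105.00969 — 3 statements merged into one kernel-verified Lean document; each statement's English description precedes it below -/
import Mathlib

section
/- For every S-sorted abstract clone X and context Ξ, the context extension ⟨Ξ⟩X is the coproduct of X and ⟨Ξ⟩Var_S in the category of S-sorted clones: clone homomorphisms ⟨Ξ⟩Var_S → Y are in natural bijection with substitutions σ ∈ Y(⋄;Ξ), and under this bijection, pairs of homomorphisms (X → Y, ⟨Ξ⟩Var_S → Y) correspond bijectively to homomorphisms ⟨Ξ⟩X → Y via composition with the two coproduct injections wk^Ξ_X : X → ⟨Ξ⟩X and the canonical homomorphism ⟨Ξ⟩Var_S → ⟨Ξ⟩X. -/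
/-- Data of an `S`-sorted abstract clone: term sets, variables, substitution. -/
structure CloneData (S : Type) : Type 1 where
  T : List S → S → Type
  varC : (Γ : List S) → (i : Fin Γ.length) → T Γ (Γ.get i)
  substC : {Γ Δ : List S} → {A : S} → T Δ A → ((i : Fin Δ.length) → T Γ (Δ.get i)) → T Γ A

namespace CloneData

variable {S : Type}

/-- Substitutions `σ ∈ X(Γ;Δ)`. -/
abbrev Sub (X : CloneData S) (Γ Δ : List S) : Type := (i : Fin Δ.length) → X.T Γ (Δ.get i)

def castT (X : CloneData S) {Γ : List S} {A B : S} (h : A = B) (t : X.T Γ A) : X.T Γ B := h ▸ t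

def castCtx (X : CloneData S) {Γ Γ' : List S} {A : S} (h : Γ = Γ') (t : X.T Γ A) : X.T Γ' A :=
  h ▸ t

end CloneData

/-- The three clone laws. -/
def IsClone {S : Type} (X : CloneData S) : Prop :=
  (∀ (Γ Δ : List S) (i : Fin Δ.length) (σ : X.Sub Γ Δ), X.substC (X.varC Δ i) σ = σ i) ∧
  (∀ (Γ : List S) (A : S) (t : X.T Γ A), X.substC t (X.varC Γ) = t) ∧
  (∀ (Γ Δ Ξ : List S) (A : S) (t : X.T Ξ A) (σ' : X.Sub Δ Ξ) (σ : X.Sub Γ Δ),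
    X.substC t (fun i => X.substC (σ' i) σ) = X.substC (X.substC t σ') σ)

/-- Clone homomorphisms: families of maps preserving variables and substitution. -/
def IsCloneHom {S : Type} (X Y : CloneData S) (f : ∀ (Γ : List S) (A : S), X.T Γ A → Y.T Γ A) :
    Prop :=
  (∀ (Γ : List S) (i : Fin Γ.length), f Γ (Γ.get i) (X.varC Γ i) = Y.varC Γ i) ∧
  (∀ (Γ Δ : List S) (A : S) (t : X.T Δ A) (σ : X.Sub Γ Δ),
    f Γ A (X.substC t σ) = Y.substC (f Δ A t) (fun i => f Γ (Δ.get i) (σ i)))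
namespace CloneAux

theorem get_append_left {α : Type} (Γ Ξ : List α) {j : ℕ} (h : j < Γ.length)
    (h2 : j < (Γ ++ Ξ).length) : (Γ ++ Ξ).get ⟨j, h2⟩ = Γ.get ⟨j, h⟩ := by
  simp [List.get_eq_getElem, List.getElem_append_left, h]

theorem get_append_right {α : Type} (Γ Ξ : List α) {j : ℕ} (h : ¬ j < Γ.length)
    (h2 : j < (Γ ++ Ξ).length) (h3 : j - Γ.length < Ξ.length) :
    (Γ ++ Ξ).get ⟨j, h2⟩ = Ξ.get ⟨j - Γ.length, h3⟩ := by
  simp only [List.get_eq_getElem]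
  rw [List.getElem_append_right (by omega)]

theorem sub_lt_of_append {α : Type} {Γ Ξ : List α} {j : ℕ} (h : ¬ j < Γ.length)
    (h2 : j < (Γ ++ Ξ).length) : j - Γ.length < Ξ.length := by
  simp only [List.length_append] at h2; omega

theorem add_lt_append {α : Type} (Γ Ξ : List α) {j : ℕ} (h : j < Ξ.length) :
    Γ.length + j < (Γ ++ Ξ).length := by
  simp only [List.length_append]; omega

theorem get_append_add {α : Type} (Γ Ξ : List α) {j : ℕ} (h : j < Ξ.length)
    (h2 : Γ.length + j < (Γ ++ Ξ).length) :
    (Γ ++ Ξ).get ⟨Γ.length + j, h2⟩ = Ξ.get ⟨j, h⟩ := by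
  simp only [List.get_eq_getElem]
  rw [List.getElem_append_right (by omega)]
  congr 1; omega

theorem le_append_length {α : Type} (Γ Ξ : List α) : Γ.length ≤ (Γ ++ Ξ).length := by
  simp [List.length_append]

end CloneAux
/-- The clone of variables: `Var_S(Γ;B) = {i | Γ.get i = B}`. -/
def VarCloneData (S : Type) : CloneData S where
  T Γ A := { i : Fin Γ.length // Γ.get i = A }
  varC Γ i := ⟨i, rfl⟩
  substC t σ := t.2 ▸ σ t.1
namespace CloneData

variable {S : Type}

/-- The weakening substitution `▷ wk^Γ_Ξ ∈ X(Γ,Ξ;Γ)`: the first `|Γ|` variables of `Γ ++ Ξ`. -/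
def wkVar (X : CloneData S) (Γ Ξ : List S) : X.Sub (Γ ++ Ξ) Γ := fun i =>
  X.castT (CloneAux.get_append_left Γ Ξ i.isLt _)
    (X.varC (Γ ++ Ξ) ⟨(i : ℕ), lt_of_lt_of_le i.isLt (CloneAux.le_append_length Γ Ξ)⟩)

/-- Extend a substitution `σ ∈ X(Γ,Ξ;Δ)` to `X(Γ,Ξ;Δ,Ξ)`, sending the extra variables of `Ξ`
to the corresponding variables of `Γ,Ξ`. -/
def extSub (X : CloneData S) (Ξ Γ Δ : List S)
    (σ : (i : Fin Δ.length) → X.T (Γ ++ Ξ) (Δ.get i)) : X.Sub (Γ ++ Ξ) (Δ ++ Ξ) := fun j =>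
  if h : (j : ℕ) < Δ.length then
    X.castT (CloneAux.get_append_left Δ Ξ h j.isLt).symm (σ ⟨(j : ℕ), h⟩)
  else
    X.castT
      ((CloneAux.get_append_add Γ Ξ (CloneAux.sub_lt_of_append h j.isLt) _).trans
        (CloneAux.get_append_right Δ Ξ h j.isLt (CloneAux.sub_lt_of_append h j.isLt)).symm)
      (X.varC (Γ ++ Ξ)
        ⟨Γ.length + ((j : ℕ) - Δ.length),
          CloneAux.add_lt_append Γ Ξ (CloneAux.sub_lt_of_append h j.isLt)⟩)

/-- The context extension `⟨Ξ⟩X`, with `(⟨Ξ⟩X)(Γ;A) = X(Γ,Ξ;A)`. -/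
def ext (X : CloneData S) (Ξ : List S) : CloneData S where
  T Γ A := X.T (Γ ++ Ξ) A
  varC Γ i := X.wkVar Γ Ξ i
  substC {Γ Δ A} t σ := X.substC t (X.extSub Ξ Γ Δ σ)

/-- The weakening map `wk^Ξ_X : X → ⟨Ξ⟩X`, sending `t` to `t[▷wk^Γ_Ξ]`. -/
def wkHom (X : CloneData S) (Ξ : List S) (Γ : List S) (A : S) (t : X.T Γ A) :
    (X.ext Ξ).T Γ A :=
  X.substC t (X.wkVar Γ Ξ)

end CloneData

/-- The canonical homomorphism `⟨Ξ⟩Var_S → ⟨Ξ⟩X`, the image of `▷ : Var_S → X` under `⟨Ξ⟩`. -/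
def extVarInj {S : Type} (X : CloneData S) (Ξ : List S) (Γ : List S) (A : S)
    (t : ((VarCloneData S).ext Ξ).T Γ A) : (X.ext Ξ).T Γ A :=
  X.castT t.2 (X.varC (Γ ++ Ξ) t.1)

namespace CloneData

variable {S : Type}

theorem substC_castT (X : CloneData S) {Γ Δ : List S} {A B : S} (h : A = B) (t : X.T Δ A)
    (σ : X.Sub Γ Δ) : X.substC (X.castT h t) σ = X.castT h (X.substC t σ) := by
  subst h; rfl

theorem map_castT (X Y : CloneData S) (f : ∀ (Γ : List S) (A : S), X.T Γ A → Y.T Γ A)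
    {Γ : List S} {A B : S} (h : A = B) (t : X.T Γ A) :
    f Γ B (X.castT h t) = Y.castT h (f Γ A t) := by
  subst h; rfl

theorem castT_castT (X : CloneData S) {Γ : List S} {A B C : S} (h : A = B) (h' : B = C)
    (t : X.T Γ A) : X.castT h' (X.castT h t) = X.castT (h.trans h') t := by
  subst h; rfl

theorem castT_family (X : CloneData S) {Γ Δ : List S} (σ : X.Sub Γ Δ) {i j : Fin Δ.length}
    (h : i = j) (p : Δ.get i = Δ.get j) : X.castT p (σ i) = σ j := by
  subst h; rfl

/-- Closed terms are weakened to `Γ` by substituting along the empty substitution. -/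
def closedWk (Y : CloneData S) (Γ : List S) {A : S} (t : Y.T [] A) : Y.T Γ A :=
  Y.substC t (fun i => i.elim0)

theorem closedWk_nil {Y : CloneData S} (hY : IsClone Y) {A : S} (t : Y.T [] A) :
    Y.closedWk [] t = t := by
  have h : (fun i => i.elim0 : Y.Sub [] []) = Y.varC [] := funext fun i => i.elim0
  rw [closedWk, h, hY.2.1]

theorem substC_closedWk {Y : CloneData S} (hY : IsClone Y) {Γ Δ : List S} {A : S}
    (t : Y.T [] A) (ρ : Y.Sub Γ Δ) : Y.substC (Y.closedWk Δ t) ρ = Y.closedWk Γ t := by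
  rw [closedWk, ← hY.2.2, closedWk]
  congr 1
  exact funext fun i => i.elim0

/-- The substitution in `Y(Γ;Γ,Ξ)` that is the identity on `Γ` and instantiates the variables
of `Ξ` by the closed terms `σ`. -/
def inst (Y : CloneData S) {Ξ : List S} (σ : Y.Sub [] Ξ) (Γ : List S) : Y.Sub Γ (Γ ++ Ξ) :=
  fun j =>
    if h : (j : ℕ) < Γ.length then
      Y.castT (CloneAux.get_append_left Γ Ξ h j.isLt).symm (Y.varC Γ ⟨j, h⟩)
    else
      Y.castT (CloneAux.get_append_right Γ Ξ h j.isLt (CloneAux.sub_lt_of_append h j.isLt)).symm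
        (Y.closedWk Γ (σ ⟨j - Γ.length, CloneAux.sub_lt_of_append h j.isLt⟩))

theorem inst_left (Y : CloneData S) {Ξ : List S} (σ : Y.Sub [] Ξ) (Γ : List S)
    (i : Fin Γ.length) (hi : (i : ℕ) < (Γ ++ Ξ).length) :
    Y.inst σ Γ ⟨i, hi⟩ =
      Y.castT (CloneAux.get_append_left Γ Ξ i.isLt hi).symm (Y.varC Γ i) := by
  simp only [inst, i.isLt, dite_true]

theorem inst_right (Y : CloneData S) {Ξ : List S} (σ : Y.Sub [] Ξ) (Γ : List S)
    (k : Fin Ξ.length) (hk : Γ.length + k < (Γ ++ Ξ).length) :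
    Y.inst σ Γ ⟨Γ.length + k, hk⟩ =
      Y.castT (CloneAux.get_append_add Γ Ξ k.isLt hk).symm (Y.closedWk Γ (σ k)) := by
  have h : ¬ Γ.length + (k : ℕ) < Γ.length := by omega
  have hk' : k = ⟨Γ.length + k - Γ.length, CloneAux.sub_lt_of_append h hk⟩ :=
    Fin.ext (by simp)
  simp only [inst, h, dite_false]
  rw [← castT_family Y (fun i => Y.closedWk Γ (σ i)) hk' (congrArg _ hk'), castT_castT]

/-- Every index of `Γ ++ Ξ` comes from `Γ` or from `Ξ`. -/
theorem append_index_cases {Γ Ξ : List S} {P : Fin (Γ ++ Ξ).length → Prop}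
    (left : ∀ (i : Fin Γ.length) (hi : (i : ℕ) < (Γ ++ Ξ).length), P ⟨i, hi⟩)
    (right : ∀ (k : Fin Ξ.length) (hk : Γ.length + k < (Γ ++ Ξ).length),
      P ⟨Γ.length + k, hk⟩) (j : Fin (Γ ++ Ξ).length) : P j := by
  by_cases h : (j : ℕ) < Γ.length
  · exact left ⟨j, h⟩ j.isLt
  · have hj : Γ.length + (j - Γ.length) = (j : ℕ) := by omega
    have := right ⟨j - Γ.length, CloneAux.sub_lt_of_append h j.isLt⟩ (hj.trans_lt j.isLt)
    simpa only [hj] using this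

theorem extSub_left (X : CloneData S) (Ξ Γ Δ : List S)
    (σ : (i : Fin Δ.length) → X.T (Γ ++ Ξ) (Δ.get i)) (i : Fin Δ.length)
    (hi : (i : ℕ) < (Δ ++ Ξ).length) :
    X.extSub Ξ Γ Δ σ ⟨i, hi⟩ =
      X.castT (CloneAux.get_append_left Δ Ξ i.isLt hi).symm (σ i) := by
  simp only [extSub, i.isLt, dite_true]

theorem extSub_right (X : CloneData S) (Ξ Γ Δ : List S)
    (σ : (i : Fin Δ.length) → X.T (Γ ++ Ξ) (Δ.get i)) (k : Fin Ξ.length)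
    (hk : Δ.length + k < (Δ ++ Ξ).length) (hk' : Γ.length + k < (Γ ++ Ξ).length) :
    X.extSub Ξ Γ Δ σ ⟨Δ.length + k, hk⟩ =
      X.castT ((CloneAux.get_append_add Γ Ξ k.isLt hk').trans
        (CloneAux.get_append_add Δ Ξ k.isLt hk).symm)
        (X.varC (Γ ++ Ξ) ⟨Γ.length + k, hk'⟩) := by
  have h : ¬ Δ.length + (k : ℕ) < Δ.length := by omega
  simp only [extSub, h, dite_false]
  have e : (⟨Γ.length + k, hk'⟩ : Fin (Γ ++ Ξ).length) =
      ⟨Γ.length + (Δ.length + k - Δ.length),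
        CloneAux.add_lt_append Γ Ξ (CloneAux.sub_lt_of_append h hk)⟩ := Fin.ext (by simp)
  rw [← castT_family X (X.varC (Γ ++ Ξ)) e (congrArg _ e), castT_castT]

/-- The map `⟨Ξ⟩X → Y` induced by `f : X → Y` and closed terms `σ ∈ Y(⋄;Ξ)`. -/
def extLift {X Y : CloneData S} {Ξ : List S}
    (f : ∀ (Γ : List S) (A : S), X.T Γ A → Y.T Γ A) (σ : Y.Sub [] Ξ)
    (Γ : List S) (A : S) (t : X.T (Γ ++ Ξ) A) : Y.T Γ A :=
  Y.substC (f (Γ ++ Ξ) A t) (Y.inst σ Γ)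

section

variable {X Y : CloneData S} {Ξ : List S} {f : ∀ (Γ : List S) (A : S), X.T Γ A → Y.T Γ A}

theorem extLift_castT_varC (hY : IsClone Y) (hf : IsCloneHom X Y f) (σ : Y.Sub [] Ξ)
    (Γ : List S) {A : S} (j : Fin (Γ ++ Ξ).length) (p : (Γ ++ Ξ).get j = A) :
    extLift f σ Γ A (X.castT p (X.varC (Γ ++ Ξ) j)) = Y.castT p (Y.inst σ Γ j) := by
  rw [extLift, map_castT X Y f, hf.1, substC_castT, hY.1]

theorem extLift_wkVar (hY : IsClone Y) (hf : IsCloneHom X Y f) (σ : Y.Sub [] Ξ)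
    (Γ : List S) (i : Fin Γ.length) :
    extLift f σ Γ (Γ.get i) (X.wkVar Γ Ξ i) = Y.varC Γ i := by
  rw [wkVar, extLift_castT_varC hY hf, inst_left, castT_castT]
  rfl

theorem extLift_extSub (hY : IsClone Y) (hf : IsCloneHom X Y f) (σ : Y.Sub [] Ξ)
    (Γ Δ : List S) (τ : (i : Fin Δ.length) → X.T (Γ ++ Ξ) (Δ.get i))
    (j : Fin (Δ ++ Ξ).length) :
    extLift f σ Γ ((Δ ++ Ξ).get j) (X.extSub Ξ Γ Δ τ j) =
      Y.substC (Y.inst σ Δ j) (fun i => extLift f σ Γ (Δ.get i) (τ i)) := by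
  induction j using append_index_cases with
  | left i hi =>
    rw [extSub_left, inst_left, substC_castT, hY.1, extLift, map_castT X Y f,
      substC_castT, extLift]
  | right k hk =>
    rw [extSub_right X Ξ Γ Δ τ k hk (CloneAux.add_lt_append Γ Ξ k.isLt),
      extLift_castT_varC hY hf, inst_right, inst_right, substC_castT,
      substC_closedWk hY, castT_castT]

theorem extLift_substC_extSub (hY : IsClone Y) (hf : IsCloneHom X Y f) (σ : Y.Sub [] Ξ)
    (Γ Δ : List S) (A : S) (t : X.T (Δ ++ Ξ) A)
    (τ : (i : Fin Δ.length) → X.T (Γ ++ Ξ) (Δ.get i)) :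
    extLift f σ Γ A (X.substC t (X.extSub Ξ Γ Δ τ)) =
      Y.substC (extLift f σ Δ A t) (fun i => extLift f σ Γ (Δ.get i) (τ i)) := by
  rw [extLift, extLift, hf.2, ← hY.2.2, ← hY.2.2]
  exact congrArg _ (funext fun j => extLift_extSub hY hf σ Γ Δ τ j)

theorem isCloneHom_extLift (hY : IsClone Y) (hf : IsCloneHom X Y f) (σ : Y.Sub [] Ξ) :
    IsCloneHom (X.ext Ξ) Y (extLift f σ) :=
  ⟨extLift_wkVar hY hf σ, extLift_substC_extSub hY hf σ⟩

theorem extLift_substC_wkVar (hY : IsClone Y) (hf : IsCloneHom X Y f) (σ : Y.Sub [] Ξ)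
    (Γ : List S) (A : S) (t : X.T Γ A) :
    extLift f σ Γ A (X.substC t (X.wkVar Γ Ξ)) = f Γ A t := by
  rw [extLift, hf.2, ← hY.2.2]
  exact (congrArg _ (funext fun i => extLift_wkVar hY hf σ Γ i)).trans (hY.2.1 _ _ _)

end

/-- A homomorphism `⟨Ξ⟩Var_S → Y` is determined by its values on the variables of `Ξ`. -/
theorem extVar_hom_apply {Y : CloneData S} {Ξ : List S}
    {h : ∀ (Γ : List S) (A : S), ((VarCloneData S).ext Ξ).T Γ A → Y.T Γ A}
    (hh : IsCloneHom ((VarCloneData S).ext Ξ) Y h) {σ : Y.Sub [] Ξ}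
    (hσ : ∀ k : Fin Ξ.length, h [] (Ξ.get k) ((VarCloneData S).varC Ξ k) = σ k)
    (Γ : List S) (A : S) (t : ((VarCloneData S).ext Ξ).T Γ A) :
    h Γ A t = Y.castT t.2 (Y.inst σ Γ t.1) := by
  obtain ⟨j, p⟩ := t
  subst p
  change h Γ _ ((VarCloneData S).varC (Γ ++ Ξ) j) = Y.inst σ Γ j
  induction j using append_index_cases with
  | left i hi =>
    rw [inst_left, ← hh.1]
    refine Eq.trans (congrArg (h Γ _) ?_) (map_castT ((VarCloneData S).ext Ξ) Y h _ _)
    exact (castT_castT (VarCloneData S) (CloneAux.get_append_left Γ Ξ i.isLt hi)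
      (CloneAux.get_append_left Γ Ξ i.isLt hi).symm
      ((VarCloneData S).varC (Γ ++ Ξ) ⟨i, hi⟩)).symm
  | right k hk =>
    have e := hh.2 Γ [] _ ((VarCloneData S).varC Ξ k) (fun i => i.elim0)
    have e' : h Γ (Ξ.get k) ((VarCloneData S).castT (CloneAux.get_append_add Γ Ξ k.isLt hk)
        ((VarCloneData S).varC (Γ ++ Ξ) ⟨Γ.length + k, hk⟩)) = Y.closedWk Γ (σ k) := by
      rw [← hσ, closedWk]
      refine Eq.trans (congrArg (h Γ _) ?_) (e.trans (congrArg _ (funext fun i => i.elim0)))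
      change _ = (VarCloneData S).extSub Ξ Γ [] (fun i => i.elim0) k
      have hk0 : ¬ (k : ℕ) < ([] : List S).length := Nat.not_lt_zero k
      rw [extSub, dif_neg hk0]
      rfl
    rw [inst_right, ← e']
    refine Eq.trans (congrArg (h Γ _) ?_) (map_castT ((VarCloneData S).ext Ξ) Y h _ _)
    exact (castT_castT (VarCloneData S) (CloneAux.get_append_add Γ Ξ k.isLt hk)
      (CloneAux.get_append_add Γ Ξ k.isLt hk).symm
      ((VarCloneData S).varC (Γ ++ Ξ) ⟨Γ.length + k, hk⟩)).symm

/-- The unique homomorphism `Var_S → Y`. -/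
def ofVar (Y : CloneData S) (Γ : List S) (A : S) (t : (VarCloneData S).T Γ A) : Y.T Γ A :=
  Y.castT t.2 (Y.varC Γ t.1)

theorem isCloneHom_ofVar {Y : CloneData S} (hY : IsClone Y) :
    IsCloneHom (VarCloneData S) Y Y.ofVar := by
  refine ⟨fun _ _ => rfl, fun Γ Δ A t σ => ?_⟩
  obtain ⟨j, p⟩ := t
  subst p
  exact (hY.1 Γ Δ j fun i => Y.ofVar Γ _ (σ i)).symm

/-- A term of `⟨Ξ⟩X` over `Γ` is its weakening, instantiated in `⟨Ξ⟩X` at the variables of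
`Γ,Ξ`. -/
theorem ext_substC_wkHom {X : CloneData S} (hX : IsClone X) (Ξ Γ : List S) (A : S)
    (t : X.T (Γ ++ Ξ) A) :
    (X.ext Ξ).substC (Γ := Γ) (X.wkHom Ξ (Γ ++ Ξ) A t) (X.varC (Γ ++ Ξ)) = t := by
  change X.substC (X.substC t _) (X.extSub Ξ Γ (Γ ++ Ξ) (X.varC (Γ ++ Ξ))) = t
  rw [← hX.2.2]
  refine (congrArg _ (funext fun i => ?_)).trans (hX.2.1 _ _ t)
  rw [wkVar, substC_castT, hX.1, extSub_left, castT_castT]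
  rfl

end CloneData

/-- `⟨Ξ⟩X` is the coproduct of `X` and `⟨Ξ⟩Var_S`: clone homomorphisms `⟨Ξ⟩Var_S → Y` are in
bijection with substitutions `σ ∈ Y(⋄;Ξ)`, and pairs of homomorphisms `(X → Y, ⟨Ξ⟩Var_S → Y)`
correspond bijectively to homomorphisms `⟨Ξ⟩X → Y` via composition with the injections
`wk^Ξ_X : X → ⟨Ξ⟩X` and `⟨Ξ⟩Var_S → ⟨Ξ⟩X`. -/
theorem ext_is_coproduct {S : Type} (Y : CloneData S) (hY : IsClone Y) (Ξ : List S) :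
    (∀ σ : (i : Fin Ξ.length) → Y.T [] (Ξ.get i),
      ∃! h : ∀ (Γ : List S) (A : S), ((VarCloneData S).ext Ξ).T Γ A → Y.T Γ A,
        IsCloneHom ((VarCloneData S).ext Ξ) Y h ∧
        (∀ i : Fin Ξ.length, h [] (Ξ.get i) ((VarCloneData S).varC Ξ i) = σ i)) ∧
    (∀ X : CloneData S, IsClone X →
      ∀ f : ∀ (Γ : List S) (A : S), X.T Γ A → Y.T Γ A, IsCloneHom X Y f →
      ∀ hV : ∀ (Γ : List S) (A : S), ((VarCloneData S).ext Ξ).T Γ A → Y.T Γ A,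
        IsCloneHom ((VarCloneData S).ext Ξ) Y hV →
        ∃! g : ∀ (Γ : List S) (A : S), (X.ext Ξ).T Γ A → Y.T Γ A,
          IsCloneHom (X.ext Ξ) Y g ∧
          (∀ (Γ : List S) (A : S) (t : X.T Γ A), g Γ A (X.wkHom Ξ Γ A t) = f Γ A t) ∧
          (∀ (Γ : List S) (A : S) (t : ((VarCloneData S).ext Ξ).T Γ A),
            g Γ A (extVarInj X Ξ Γ A t) = hV Γ A t)) := by
  refine ⟨fun σ => ⟨CloneData.extLift Y.ofVar σ, ⟨?_, fun i => ?_⟩, fun h hh => ?_⟩,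
    fun X hX f hf hV hhV => ?_⟩
  · exact CloneData.isCloneHom_extLift hY (CloneData.isCloneHom_ofVar hY) σ
  · refine (CloneData.extLift_castT_varC hY (CloneData.isCloneHom_ofVar hY) σ [] i rfl).trans ?_
    exact CloneData.closedWk_nil hY (σ i)
  · funext Γ A t
    rw [CloneData.extVar_hom_apply hh.1 hh.2]
    exact (hY.1 _ _ _ _ ▸ CloneData.substC_castT Y t.2 (Y.varC (Γ ++ Ξ) t.1) (Y.inst σ Γ)).symm
  · have hσ := CloneData.extVar_hom_apply hhV (fun _ => rfl)
    refine ⟨CloneData.extLift f fun k => hV [] (Ξ.get k) ((VarCloneData S).varC Ξ k),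
      ⟨CloneData.isCloneHom_extLift hY hf _, CloneData.extLift_substC_wkVar hY hf _, fun Γ A t => ?_⟩,
      fun g hg => ?_⟩
    · rw [hσ]
      exact CloneData.extLift_castT_varC hY hf _ Γ t.1 t.2
    · obtain ⟨hg, hwk, hvar⟩ := hg
      funext Γ A t
      refine (congrArg (g Γ A) (CloneData.ext_substC_wkHom hX Ξ Γ A t)).symm.trans ?_
      refine (hg.2 Γ (Γ ++ Ξ) A _ (X.varC (Γ ++ Ξ))).trans ?_
      exact congrArg₂ Y.substC (hwk (Γ ++ Ξ) A t)
        (funext fun i => (hvar Γ _ ⟨i, rfl⟩).trans (hσ Γ _ ⟨i, rfl⟩))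
end

section
/- Induction principle for second-order syntax: let P = (Σ,E) be an S-sorted second-order presentation, (Y, ⟦–⟧) a P-algebra, f : X → Y a clone homomorphism from an S-sorted clone X, and Q a predicate over Y (a family of subsets Q(Γ;A) ⊆ Y(Γ;A) containing all variables and closed under substitution). If (i) for every operator o ∈ Σ((Δ₁;A₁),…,(Δₙ;Aₙ);B), every context Γ, and all t_i ∈ Q(Γ,Δ_i;A_i) we have ⟦o⟧_Γ(t₁,…,tₙ) ∈ Q(Γ;B), and (ii) f_{Γ;A}(t) ∈ Q(Γ;A) for every t ∈ X(Γ;A), then f̂_{Γ;A}(t) ∈ Q(Γ;A) for every term t ∈ (F_P X)(Γ;A) of the free P-algebra, where f̂ : F_P X → Y is the unique algebra homomorphism extending f. -/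
namespace CloneData

/-- Lift a substitution `σ ∈ Y(Ξ;Γ)` to `σ↑Δ ∈ Y(Ξ,Δ;Γ,Δ)`: weaken the terms of `σ` and send
the extra variables of `Δ` to the corresponding variables of `Ξ,Δ`. -/
def liftSub {S : Type} (Y : CloneData S) {Ξ Γ : List S} (σ : Y.Sub Ξ Γ) (Δ : List S) :
    Y.Sub (Ξ ++ Δ) (Γ ++ Δ) := fun j =>
  if h : (j : ℕ) < Γ.length then
    Y.castT (CloneAux.get_append_left Γ Δ h j.isLt).symm
      (Y.substC (σ ⟨(j : ℕ), h⟩) (Y.wkVar Ξ Δ))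
  else
    Y.castT
      ((CloneAux.get_append_add Ξ Δ (CloneAux.sub_lt_of_append h j.isLt) _).trans
        (CloneAux.get_append_right Γ Δ h j.isLt (CloneAux.sub_lt_of_append h j.isLt)).symm)
      (Y.varC (Ξ ++ Δ)
        ⟨Ξ.length + ((j : ℕ) - Γ.length),
          CloneAux.add_lt_append Ξ Δ (CloneAux.sub_lt_of_append h j.isLt)⟩)

end CloneData
/-- Metavariable contexts: lists of (context, sort) pairs. -/
abbrev MCtx (S : Type) : Type := List (List S × S)

/-- An `S`-sorted second-order signature: a set of operators for each second-order arity. -/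
structure SOSig (S : Type) : Type 1 where
  ops : MCtx S → S → Type

/-- Second-order terms over a signature, in a metavariable context `Ψ` and variable context:
variables, metavariable applications, and operator applications (binding variables). -/
inductive SOTerm {S : Type} (Sg : SOSig S) (Ψ : MCtx S) : List S → S → Type
  | var {Γ : List S} (i : Fin Γ.length) : SOTerm Sg Ψ Γ (Γ.get i)
  | mvar {Γ : List S} (k : Fin Ψ.length)
      (args : (i : Fin (Ψ.get k).1.length) → SOTerm Sg Ψ Γ ((Ψ.get k).1.get i)) :
      SOTerm Sg Ψ Γ ((Ψ.get k).2)
  | op {Γ : List S} {Φ : MCtx S} {B : S} (o : Sg.ops Φ B)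
      (args : (i : Fin Φ.length) → SOTerm Sg Ψ (Γ ++ (Φ.get i).1) ((Φ.get i).2)) :
      SOTerm Sg Ψ Γ B

/-- An `S`-sorted second-order presentation: a signature with sets of equations between
second-order terms (in empty variable context). -/
structure SOPres (S : Type) extends SOSig S : Type 1 where
  eqs : (Ψ : MCtx S) → (B : S) → Set (SOTerm toSOSig Ψ [] B × SOTerm toSOSig Ψ [] B)

/-- An interpretation of the operators of a second-order signature in a clone `Y`. -/
def OpInterp {S : Type} (Sg : SOSig S) (Y : CloneData S) : Type :=
  ∀ (Φ : MCtx S) (B : S), Sg.ops Φ B → ∀ (Γ : List S),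
    ((i : Fin Φ.length) → Y.T (Γ ++ (Φ.get i).1) ((Φ.get i).2)) → Y.T Γ B

/-- The interpretations of operators commute with substitution (the `Σ`-algebra condition). -/
def OpsCommute {S : Type} {Sg : SOSig S} (Y : CloneData S) (I : OpInterp Sg Y) : Prop :=
  ∀ (Φ : MCtx S) (B : S) (o : Sg.ops Φ B) (Γ Ξ : List S) (σ : Y.Sub Ξ Γ)
    (ts : (i : Fin Φ.length) → Y.T (Γ ++ (Φ.get i).1) ((Φ.get i).2)),
    Y.substC (I Φ B o Γ ts) σ = I Φ B o Ξ (fun i => Y.substC (ts i) (Y.liftSub σ (Φ.get i).1))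

/-- The interpretation `⟦t⟧_Γ` of a second-order term in a `Σ`-algebra, given values of its
metavariables. -/
def semSO {S : Type} {Sg : SOSig S} (Y : CloneData S) (I : OpInterp Sg Y) {Ψ : MCtx S}
    (Γ : List S) (ρ : (k : Fin Ψ.length) → Y.T (Γ ++ (Ψ.get k).1) ((Ψ.get k).2)) :
    {Ξ : List S} → {B : S} → SOTerm Sg Ψ Ξ B → Y.T (Γ ++ Ξ) B
  | Ξ, _, SOTerm.var i =>
      Y.castT (CloneAux.get_append_add Γ Ξ i.isLt _)
        (Y.varC (Γ ++ Ξ) ⟨Γ.length + (i : ℕ), CloneAux.add_lt_append Γ Ξ i.isLt⟩)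
  | Ξ, _, SOTerm.mvar k args =>
      Y.substC (ρ k) (fun j =>
        if h : (j : ℕ) < Γ.length then
          Y.castT
            ((CloneAux.get_append_left Γ Ξ h
                (lt_of_lt_of_le h (CloneAux.le_append_length Γ Ξ))).trans
              (CloneAux.get_append_left Γ (Ψ.get k).1 h j.isLt).symm)
            (Y.varC (Γ ++ Ξ) ⟨(j : ℕ), lt_of_lt_of_le h (CloneAux.le_append_length Γ Ξ)⟩)
        else
          Y.castT
            (CloneAux.get_append_right Γ (Ψ.get k).1 h j.isLt
              (CloneAux.sub_lt_of_append h j.isLt)).symm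
            (semSO Y I Γ ρ (args ⟨(j : ℕ) - Γ.length, CloneAux.sub_lt_of_append h j.isLt⟩)))
  | Ξ, _, SOTerm.op o args =>
      I _ _ o (Γ ++ Ξ)
        (fun i => Y.castCtx (List.append_assoc Γ Ξ _).symm (semSO Y I Γ ρ (args i)))

/-- A `(Σ,E)`-algebra additionally satisfies the equations of the presentation. -/
def SatisfiesEqs {S : Type} (P : SOPres S) (Y : CloneData S) (I : OpInterp P.toSOSig Y) :
    Prop :=
  ∀ (Ψ : MCtx S) (B : S) (t u : SOTerm P.toSOSig Ψ [] B), (t, u) ∈ P.eqs Ψ B →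
    ∀ (Γ : List S) (ρ : (k : Fin Ψ.length) → Y.T (Γ ++ (Ψ.get k).1) ((Ψ.get k).2)),
      semSO Y I Γ ρ t = semSO Y I Γ ρ u

/-- Homomorphisms of `Σ`-algebras: clone homomorphisms preserving the operators. -/
def IsAlgHom {S : Type} {Sg : SOSig S} (X Y : CloneData S) (IX : OpInterp Sg X)
    (IY : OpInterp Sg Y) (f : ∀ (Γ : List S) (A : S), X.T Γ A → Y.T Γ A) : Prop :=
  IsCloneHom X Y f ∧
  ∀ (Φ : MCtx S) (B : S) (o : Sg.ops Φ B) (Γ : List S)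
    (ts : (i : Fin Φ.length) → X.T (Γ ++ (Φ.get i).1) ((Φ.get i).2)),
    f Γ B (IX Φ B o Γ ts) = IY Φ B o Γ (fun i => f _ _ (ts i))
/-- A predicate over a clone `Y`: a family of subsets containing all variables and closed
under substitution. -/
def IsPredicate {S : Type} (Y : CloneData S) (Q : ∀ (Γ : List S) (A : S), Set (Y.T Γ A)) :
    Prop :=
  (∀ (Γ : List S) (i : Fin Γ.length), Y.varC Γ i ∈ Q Γ (Γ.get i)) ∧
  (∀ (Γ Δ : List S) (B : S) (t : Y.T Δ B) (σ : Y.Sub Γ Δ),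
    t ∈ Q Δ B → (∀ j, σ j ∈ Q Γ (Δ.get j)) → Y.substC t σ ∈ Q Γ B)

/-- `F` together with `η : X → F` is the free `P`-algebra on `X`. -/
def IsFreeAlgebra {S : Type} (P : SOPres S) (X : CloneData S) (F : CloneData S)
    (IF : OpInterp P.toSOSig F) (η : ∀ (Γ : List S) (A : S), X.T Γ A → F.T Γ A) : Prop :=
  IsClone F ∧ OpsCommute F IF ∧ SatisfiesEqs P F IF ∧ IsCloneHom X F η ∧
  ∀ (Y : CloneData S) (IY : OpInterp P.toSOSig Y),
    IsClone Y → OpsCommute Y IY → SatisfiesEqs P Y IY →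
    ∀ f : ∀ (Γ : List S) (A : S), X.T Γ A → Y.T Γ A, IsCloneHom X Y f →
      ∃! g : ∀ (Γ : List S) (A : S), F.T Γ A → Y.T Γ A,
        IsAlgHom F Y IF IY g ∧ ∀ (Γ : List S) (A : S) (t : X.T Γ A),
          g Γ A (η Γ A t) = f Γ A t

section Transport

variable {S : Type} {Sg : SOSig S} {X Y Z : CloneData S}
  {f : ∀ (Γ : List S) (A : S), X.T Γ A → Y.T Γ A}
  {g : ∀ (Γ : List S) (A : S), Y.T Γ A → Z.T Γ A}
  {IX : OpInterp Sg X} {IY : OpInterp Sg Y} {IZ : OpInterp Sg Z}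

theorem CloneData.map_castT_s10 (f : ∀ (Γ : List S) (A : S), X.T Γ A → Y.T Γ A)
    {Γ : List S} {A B : S} (h : A = B) (t : X.T Γ A) :
    f Γ B (X.castT h t) = Y.castT h (f Γ A t) := by
  subst h; rfl

theorem CloneData.map_castCtx (f : ∀ (Γ : List S) (A : S), X.T Γ A → Y.T Γ A)
    {Γ Γ' : List S} {A : S} (h : Γ = Γ') (t : X.T Γ A) :
    f Γ' A (X.castCtx h t) = Y.castCtx h (f Γ A t) := by
  subst h; rfl

theorem IsCloneHom.comp (hg : IsCloneHom Y Z g) (hf : IsCloneHom X Y f) :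
    IsCloneHom X Z (fun Γ A t => g Γ A (f Γ A t)) :=
  ⟨fun Γ i => (congrArg (g _ _) (hf.1 Γ i)).trans (hg.1 Γ i),
    fun Γ Δ A t σ => (congrArg (g _ _) (hf.2 Γ Δ A t σ)).trans (hg.2 Γ Δ A _ _)⟩

theorem IsAlgHom.comp (hg : IsAlgHom Y Z IY IZ g) (hf : IsAlgHom X Y IX IY f) :
    IsAlgHom X Z IX IZ (fun Γ A t => g Γ A (f Γ A t)) :=
  ⟨hg.1.comp hf.1, fun Φ B o Γ ts =>
    (congrArg (g _ _) (hf.2 Φ B o Γ ts)).trans (hg.2 Φ B o Γ _)⟩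

theorem IsCloneHom.map_wkVar (hf : IsCloneHom X Y f) (Γ Ξ : List S) (i : Fin Γ.length) :
    f _ _ (X.wkVar Γ Ξ i) = Y.wkVar Γ Ξ i := by
  unfold CloneData.wkVar
  rw [CloneData.map_castT_s10 f, hf.1]

theorem IsCloneHom.map_liftSub (hf : IsCloneHom X Y f) {Ξ Γ : List S} (σ : X.Sub Ξ Γ)
    (Δ : List S) (j : Fin (Γ ++ Δ).length) :
    f _ _ (X.liftSub σ Δ j) = Y.liftSub (fun i => f _ _ (σ i)) Δ j := by
  unfold CloneData.liftSub
  split_ifs with h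
  · rw [CloneData.map_castT_s10 f, hf.2]
    simp only [hf.map_wkVar]
  · rw [CloneData.map_castT_s10 f, hf.1]

theorem IsAlgHom.map_semSO (hf : IsAlgHom X Y IX IY f) {Ψ : MCtx S} (Γ : List S)
    (ρ : (k : Fin Ψ.length) → X.T (Γ ++ (Ψ.get k).1) ((Ψ.get k).2)) {Ξ : List S} {B : S}
    (t : SOTerm Sg Ψ Ξ B) :
    f _ _ (semSO X IX Γ ρ t) = semSO Y IY Γ (fun k => f _ _ (ρ k)) t := by
  induction t with
  | var i =>
    simp only [semSO]
    rw [CloneData.map_castT_s10 f, hf.1.1]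
  | mvar k args ih =>
    simp only [semSO]
    rw [hf.1.2]
    congr 1
    funext j
    split_ifs with h
    · rw [CloneData.map_castT_s10 f, hf.1.1]
    · rw [CloneData.map_castT_s10 f, ih]
  | op o args ih =>
    simp only [semSO]
    rw [hf.2]
    congr 1
    funext i
    rw [CloneData.map_castCtx f, ih]

theorem IsCloneHom.isClone_of_injective (hf : IsCloneHom X Y f)
    (hinj : ∀ Γ A, Function.Injective (f Γ A)) (hY : IsClone Y) : IsClone X := by
  refine ⟨fun Γ Δ i σ => hinj _ _ ?_, fun Γ A t => hinj _ _ ?_,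
    fun Γ Δ Ξ A t σ' σ => hinj _ _ ?_⟩
  · rw [hf.2, hf.1, hY.1]
  · rw [hf.2]
    simp only [hf.1]
    exact hY.2.1 _ _ _
  · simp only [hf.2]
    exact hY.2.2 _ _ _ _ _ _ _

theorem IsAlgHom.opsCommute_of_injective (hf : IsAlgHom X Y IX IY f)
    (hinj : ∀ Γ A, Function.Injective (f Γ A)) (hY : OpsCommute Y IY) : OpsCommute X IX := by
  intro Φ B o Γ Ξ σ ts
  apply hinj
  rw [hf.1.2, hf.2, hf.2, hY]
  congr 1
  funext i
  rw [hf.1.2]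
  congr 1
  funext j
  exact (hf.1.map_liftSub σ _ j).symm

theorem IsAlgHom.satisfiesEqs_of_injective {P : SOPres S} {IX : OpInterp P.toSOSig X}
    {IY : OpInterp P.toSOSig Y} (hf : IsAlgHom X Y IX IY f)
    (hinj : ∀ Γ A, Function.Injective (f Γ A)) (hY : SatisfiesEqs P Y IY) :
    SatisfiesEqs P X IX := by
  intro Ψ B t u htu Γ ρ
  apply hinj
  rw [hf.map_semSO, hf.map_semSO]
  exact hY Ψ B t u htu Γ _

end Transport

/-- The subclone of `Y` carved out by a predicate. -/
def IsPredicate.subclone {S : Type} {Y : CloneData S}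
    {Q : ∀ (Γ : List S) (A : S), Set (Y.T Γ A)} (hQ : IsPredicate Y Q) : CloneData S where
  T Γ A := {t : Y.T Γ A // t ∈ Q Γ A}
  varC Γ i := ⟨Y.varC Γ i, hQ.1 Γ i⟩
  substC t σ := ⟨Y.substC t.1 (fun i => (σ i).1), hQ.2 _ _ _ _ _ t.2 (fun j => (σ j).2)⟩

/-- Induction principle for second-order syntax: if a predicate `Q` over a `P`-algebra `Y` is
closed under the interpreted operators and contains the image of a clone homomorphism
`f : X → Y`, then it contains the image of the extension `f̂ : F_P X → Y` of `f` to the free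
`P`-algebra on `X`. -/
theorem induction_second_order_syntax {S : Type} (P : SOPres S)
    (Y : CloneData S) (IY : OpInterp P.toSOSig Y)
    (hY : IsClone Y) (hYc : OpsCommute Y IY) (hYe : SatisfiesEqs P Y IY)
    (X : CloneData S) (hX : IsClone X)
    (f : ∀ (Γ : List S) (A : S), X.T Γ A → Y.T Γ A) (hf : IsCloneHom X Y f)
    (Q : ∀ (Γ : List S) (A : S), Set (Y.T Γ A)) (hQ : IsPredicate Y Q)
    (F : CloneData S) (IF : OpInterp P.toSOSig F)
    (η : ∀ (Γ : List S) (A : S), X.T Γ A → F.T Γ A)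
    (hF : IsFreeAlgebra P X F IF η)
    (g : ∀ (Γ : List S) (A : S), F.T Γ A → Y.T Γ A)
    (hg : IsAlgHom F Y IF IY g) (hgη : ∀ Γ A t, g Γ A (η Γ A t) = f Γ A t)
    (hops : ∀ (Φ : MCtx S) (B : S) (o : P.ops Φ B) (Γ : List S)
      (ts : (i : Fin Φ.length) → Y.T (Γ ++ (Φ.get i).1) ((Φ.get i).2)),
      (∀ i, ts i ∈ Q (Γ ++ (Φ.get i).1) ((Φ.get i).2)) → IY Φ B o Γ ts ∈ Q Γ B)
    (hfQ : ∀ (Γ : List S) (A : S) (t : X.T Γ A), f Γ A t ∈ Q Γ A) :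
    ∀ (Γ : List S) (A : S) (t : F.T Γ A), g Γ A t ∈ Q Γ A := by
  let Z : CloneData S := hQ.subclone
  let IZ : OpInterp P.toSOSig Z := fun Φ B o Γ ts =>
    ⟨IY Φ B o Γ (fun i => (ts i).1), hops Φ B o Γ _ (fun i => (ts i).2)⟩
  let incl : ∀ (Γ : List S) (A : S), Z.T Γ A → Y.T Γ A := fun _ _ t => t.1
  have hincl : IsAlgHom Z Y IZ IY incl :=
    ⟨⟨fun _ _ => rfl, fun _ _ _ _ _ => rfl⟩, fun _ _ _ _ _ => rfl⟩
  have hinj : ∀ Γ A, Function.Injective (incl Γ A) := fun _ _ => Subtype.val_injective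
  obtain ⟨-, -, -, -, hfree⟩ := hF
  obtain ⟨k, ⟨hk, hkη⟩, -⟩ := hfree Z IZ (hincl.1.isClone_of_injective hinj hY)
    (hincl.opsCommute_of_injective hinj hYc) (hincl.satisfiesEqs_of_injective hinj hYe)
    (fun Γ A t => ⟨f Γ A t, hfQ Γ A t⟩)
    ⟨fun Γ i => Subtype.ext (hf.1 Γ i), fun Γ Δ A t σ => Subtype.ext (hf.2 Γ Δ A t σ)⟩
  have hgk : g = fun Γ A t => incl Γ A (k Γ A t) :=
    (hfree Y IY hY hYc hYe f hf).unique ⟨hg, hgη⟩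
      ⟨hincl.comp hk, fun Γ A t => congrArg Subtype.val (hkη Γ A t)⟩
  intro Γ A t
  rw [hgk]
  exact (k Γ A t).2
end

section
/- Adequacy of the set-theoretic model of the STLC with booleans: for closed terms t, t' of base (boolean) type in the simply typed λ-calculus with constants true, false and if-then-else, considered up to the congruence ≈_{βη} generated by β, η, and the if-then-else equations, if the interpretations of t and t' in the standard set-theoretic model with booleans interpreted as the two-element set 𝔹 = {tt, ff} are equal, then t ≈_{βη} t'. -/
/-- Simple types: freely generated by a base type and function types. -/
inductive Ty : Type
  | base : Ty
  | arrow : Ty → Ty → Ty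

/-- Intrinsically-typed de Bruijn terms of the STLC with booleans. -/
inductive TmB : List Ty → Ty → Type
  | var : {Γ : List Ty} → (i : Fin Γ.length) → TmB Γ (Γ.get i)
  | app : {Γ : List Ty} → {A B : Ty} → TmB Γ (Ty.arrow A B) → TmB Γ A → TmB Γ B
  | lam : {Γ : List Ty} → {A B : Ty} → TmB (A :: Γ) B → TmB Γ (Ty.arrow A B)
  | tt : {Γ : List Ty} → TmB Γ Ty.base
  | ff : {Γ : List Ty} → TmB Γ Ty.base
  | ite : {Γ : List Ty} → {A : Ty} → TmB Γ Ty.base → TmB Γ A → TmB Γ A → TmB Γ A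

/-- Variable renamings. -/
def RenB (Δ Γ : List Ty) : Type := (i : Fin Γ.length) → { j : Fin Δ.length // Δ.get j = Γ.get i }

def RenB.lift {Δ Γ : List Ty} (ρ : RenB Δ Γ) (A : Ty) : RenB (A :: Δ) (A :: Γ) := fun i =>
  Fin.cases ⟨⟨0, by simp⟩, rfl⟩ (fun i' => ⟨(ρ i').1.succ, (ρ i').2⟩) i

def RenB.up (Δ : List Ty) (A : Ty) : RenB (A :: Δ) Δ := fun i => ⟨i.succ, rfl⟩

def TmB.rename : {Γ Δ : List Ty} → {A : Ty} → TmB Γ A → RenB Δ Γ → TmB Δ A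
  | _, _, _, TmB.var i, ρ => (ρ i).2 ▸ TmB.var (ρ i).1
  | _, _, _, TmB.app f a, ρ => TmB.app (f.rename ρ) (a.rename ρ)
  | _, _, _, TmB.lam t, ρ => TmB.lam (t.rename (ρ.lift _))
  | _, _, _, TmB.tt, _ => TmB.tt
  | _, _, _, TmB.ff, _ => TmB.ff
  | _, _, _, TmB.ite b t u, ρ => TmB.ite (b.rename ρ) (t.rename ρ) (u.rename ρ)

/-- Simultaneous substitutions. -/
def SbB (Δ Γ : List Ty) : Type := (i : Fin Γ.length) → TmB Δ (Γ.get i)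

def SbB.lift {Δ Γ : List Ty} (σ : SbB Δ Γ) (A : Ty) : SbB (A :: Δ) (A :: Γ) := fun i =>
  Fin.cases (TmB.var ⟨0, by simp⟩) (fun i' => (σ i').rename (RenB.up Δ A)) i

def TmB.subst : {Γ Δ : List Ty} → {A : Ty} → TmB Γ A → SbB Δ Γ → TmB Δ A
  | _, _, _, TmB.var i, σ => σ i
  | _, _, _, TmB.app f a, σ => TmB.app (f.subst σ) (a.subst σ)
  | _, _, _, TmB.lam t, σ => TmB.lam (t.subst (σ.lift _))
  | _, _, _, TmB.tt, _ => TmB.tt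
  | _, _, _, TmB.ff, _ => TmB.ff
  | _, _, _, TmB.ite b t u, σ => TmB.ite (b.subst σ) (t.subst σ) (u.subst σ)

def SbB.single {Γ : List Ty} {A : Ty} (u : TmB Γ A) : SbB Γ (A :: Γ) := fun i =>
  Fin.cases u (fun i' => TmB.var i') i

/-- The congruence generated by β, η, and the if-then-else equations. -/
inductive EqB : {Γ : List Ty} → {A : Ty} → TmB Γ A → TmB Γ A → Prop
  | refl {Γ : List Ty} {A : Ty} {t : TmB Γ A} : EqB t t
  | symm {Γ : List Ty} {A : Ty} {t u : TmB Γ A} : EqB t u → EqB u t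
  | trans {Γ : List Ty} {A : Ty} {t u v : TmB Γ A} : EqB t u → EqB u v → EqB t v
  | congApp {Γ : List Ty} {A B : Ty} {f f' : TmB Γ (Ty.arrow A B)} {a a' : TmB Γ A} :
      EqB f f' → EqB a a' → EqB (TmB.app f a) (TmB.app f' a')
  | congLam {Γ : List Ty} {A B : Ty} {t t' : TmB (A :: Γ) B} :
      EqB t t' → EqB (TmB.lam t) (TmB.lam t')
  | congIte {Γ : List Ty} {A : Ty} {b b' : TmB Γ Ty.base} {t t' u u' : TmB Γ A} :
      EqB b b' → EqB t t' → EqB u u' → EqB (TmB.ite b t u) (TmB.ite b' t' u')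
  | beta {Γ : List Ty} {A B : Ty} (t : TmB (A :: Γ) B) (u : TmB Γ A) :
      EqB (TmB.app (TmB.lam t) u) (t.subst (SbB.single u))
  | eta {Γ : List Ty} {A B : Ty} (t : TmB Γ (Ty.arrow A B)) :
      EqB t (TmB.lam (TmB.app (t.rename (RenB.up Γ A)) (TmB.var ⟨0, by simp⟩)))
  | iteTrue {Γ : List Ty} {A : Ty} (t u : TmB Γ A) : EqB (TmB.ite TmB.tt t u) t
  | iteFalse {Γ : List Ty} {A : Ty} (t u : TmB Γ A) : EqB (TmB.ite TmB.ff t u) u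

/-- The set-theoretic interpretation of simple types with `⟦b⟧ = Bool`. -/
def TyI : Ty → Type
  | Ty.base => Bool
  | Ty.arrow A B => TyI A → TyI B

/-- The standard set-theoretic interpretation of terms. -/
def TmB.sem : {Γ : List Ty} → {A : Ty} → TmB Γ A →
    ((i : Fin Γ.length) → TyI (Γ.get i)) → TyI A
  | _, _, TmB.var i, ξ => ξ i
  | _, _, TmB.app f a, ξ => (f.sem ξ) (a.sem ξ)
  | _, _, TmB.lam t, ξ => fun a => t.sem (fun i => Fin.cases a ξ i)
  | _, _, TmB.tt, _ => (true : Bool)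
  | _, _, TmB.ff, _ => (false : Bool)
  | _, _, TmB.ite b t u, ξ => cond (b.sem ξ) (t.sem ξ) (u.sem ξ)

namespace TmB

theorem rename_cast {Γ Δ : List Ty} {A B : Ty} (h : A = B) (t : TmB Γ A) (ρ : RenB Δ Γ) :
    (h ▸ t : TmB Γ B).rename ρ = h ▸ t.rename ρ := by
  subst h; rfl

theorem subst_cast {Γ Δ : List Ty} {A B : Ty} (h : A = B) (t : TmB Γ A) (σ : SbB Δ Γ) :
    (h ▸ t : TmB Γ B).subst σ = h ▸ t.subst σ := by
  subst h; rfl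

/-- A renaming, seen as a substitution by variables. -/
def _root_.RenB.toSbB {Δ Γ : List Ty} (ρ : RenB Δ Γ) : SbB Δ Γ :=
  fun i => (ρ i).2 ▸ TmB.var (ρ i).1

theorem _root_.RenB.toSbB_lift {Δ Γ : List Ty} (ρ : RenB Δ Γ) (A : Ty) :
    (ρ.lift A).toSbB = ρ.toSbB.lift A := by
  funext i
  refine Fin.cases rfl (fun i => ?_) i
  exact (rename_cast (ρ i).2 (TmB.var (ρ i).1) (RenB.up Δ A)).symm

theorem rename_eq_subst {Γ : List Ty} {A : Ty} (t : TmB Γ A) :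
    ∀ {Δ : List Ty} (ρ : RenB Δ Γ), t.rename ρ = t.subst ρ.toSbB := by
  induction t with
  | var i => intro Δ ρ; rfl
  | app f a ihf iha => intro Δ ρ; simp only [rename, subst, ihf, iha]
  | lam t ih => intro Δ ρ; simp only [rename, subst, ih, RenB.toSbB_lift]
  | tt => intro Δ ρ; rfl
  | ff => intro Δ ρ; rfl
  | ite b t u ihb iht ihu => intro Δ ρ; simp only [rename, subst, ihb, iht, ihu]

/-- Precomposition of a substitution with a renaming. -/
def _root_.SbB.compRen {Θ Δ Γ : List Ty} (σ : SbB Θ Δ) (ρ : RenB Δ Γ) : SbB Θ Γ :=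
  fun i => (ρ i).2 ▸ σ (ρ i).1

theorem _root_.SbB.compRen_lift {Θ Δ Γ : List Ty} (σ : SbB Θ Δ) (ρ : RenB Δ Γ) (A : Ty) :
    (σ.lift A).compRen (ρ.lift A) = (σ.compRen ρ).lift A := by
  funext i
  refine Fin.cases rfl (fun i => ?_) i
  exact (rename_cast (ρ i).2 (σ (ρ i).1) (RenB.up Θ A)).symm

theorem rename_subst {Γ : List Ty} {A : Ty} (t : TmB Γ A) :
    ∀ {Δ Θ : List Ty} (ρ : RenB Δ Γ) (σ : SbB Θ Δ),
      (t.rename ρ).subst σ = t.subst (σ.compRen ρ) := by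
  induction t with
  | var i => intro Δ Θ ρ σ; exact subst_cast (ρ i).2 (TmB.var (ρ i).1) σ
  | app f a ihf iha => intro Δ Θ ρ σ; simp only [rename, subst, ihf, iha]
  | lam t ih => intro Δ Θ ρ σ; simp only [rename, subst, ih, SbB.compRen_lift]
  | tt => intro Δ Θ ρ σ; rfl
  | ff => intro Δ Θ ρ σ; rfl
  | ite b t u ihb iht ihu => intro Δ Θ ρ σ; simp only [rename, subst, ihb, iht, ihu]

/-- Renaming along `ρ` commutes with weakening. -/
theorem rename_up_rename_lift {Γ Δ : List Ty} {A B : Ty} (t : TmB Γ B) (ρ : RenB Δ Γ) :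
    (t.rename (RenB.up Γ A)).rename (ρ.lift A) = (t.rename ρ).rename (RenB.up Δ A) := by
  rw [rename_eq_subst _ (ρ.lift A), rename_eq_subst _ (RenB.up Δ A), rename_subst, rename_subst]
  congr 1

theorem subst_rename {Γ : List Ty} {A : Ty} (t : TmB Γ A) :
    ∀ {Δ Θ : List Ty} (σ : SbB Δ Γ) (ρ : RenB Θ Δ),
      (t.subst σ).rename ρ = t.subst (fun i => (σ i).rename ρ) := by
  induction t with
  | var i => intro Δ Θ σ ρ; rfl
  | app f a ihf iha => intro Δ Θ σ ρ; simp only [rename, subst, ihf, iha]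
  | lam t ih =>
    intro Δ Θ σ ρ
    simp only [rename, subst, ih]
    congr 2
    funext i
    exact Fin.cases rfl (fun i => rename_up_rename_lift (σ i) ρ) i
  | tt => intro Δ Θ σ ρ; rfl
  | ff => intro Δ Θ σ ρ; rfl
  | ite b t u ihb iht ihu => intro Δ Θ σ ρ; simp only [rename, subst, ihb, iht, ihu]

theorem subst_subst {Γ : List Ty} {A : Ty} (t : TmB Γ A) :
    ∀ {Δ Θ : List Ty} (σ : SbB Δ Γ) (τ : SbB Θ Δ),
      (t.subst σ).subst τ = t.subst (fun i => (σ i).subst τ) := by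
  induction t with
  | var i => intro Δ Θ σ τ; rfl
  | app f a ihf iha => intro Δ Θ σ τ; simp only [subst, ihf, iha]
  | lam t ih =>
    intro Δ Θ σ τ
    simp only [subst, ih]
    congr 2
    funext i
    refine Fin.cases rfl (fun i => ?_) i
    exact (rename_subst (σ i) _ _).trans (subst_rename (σ i) τ _).symm
  | tt => intro Δ Θ σ τ; rfl
  | ff => intro Δ Θ σ τ; rfl
  | ite b t u ihb iht ihu => intro Δ Θ σ τ; simp only [subst, ihb, iht, ihu]

theorem subst_var {Γ : List Ty} {A : Ty} (t : TmB Γ A) : t.subst (fun i => TmB.var i) = t := by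
  have lift_var (Γ : List Ty) (A : Ty) :
      SbB.lift (fun i => TmB.var i : SbB Γ Γ) A = fun i => TmB.var i := by
    funext i
    exact Fin.cases rfl (fun _ => rfl) i
  induction t with
  | var i => rfl
  | app f a ihf iha => simp only [subst, ihf, iha]
  | lam t ih => simp only [subst, lift_var, ih]
  | tt => rfl
  | ff => rfl
  | ite b t u ihb iht ihu => simp only [subst, ihb, iht, ihu]

/-- The closed boolean constant denoting a given truth value. -/
def ofBool : Bool → TmB [] Ty.base
  | true => TmB.tt
  | false => TmB.ff

/-- The logical relation between closed terms and elements of the set-theoretic model. -/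
def Realizes : (A : Ty) → TmB [] A → TyI A → Prop
  | Ty.base, t, b => EqB t (ofBool b)
  | Ty.arrow A B, t, f => ∀ (u : TmB [] A) (a : TyI A), Realizes A u a → Realizes B (app t u) (f a)

theorem Realizes.of_eqB : ∀ {A : Ty} {t u : TmB [] A} {a : TyI A},
    EqB t u → Realizes A u a → Realizes A t a
  | Ty.base, _, _, _, h, hu => h.trans hu
  | Ty.arrow _ _, _, _, _, h, hu => fun v b hv => (hu v b hv).of_eqB (h.congApp EqB.refl)

/-- Fundamental lemma of the logical relation. -/
theorem realizes_subst_sem {Γ : List Ty} {A : Ty} (t : TmB Γ A) :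
    ∀ (σ : SbB [] Γ) (ξ : (i : Fin Γ.length) → TyI (Γ.get i)),
      (∀ i, Realizes (Γ.get i) (σ i) (ξ i)) → Realizes A (t.subst σ) (t.sem ξ) := by
  induction t with
  | var i => intro σ ξ h; exact h i
  | app f a ihf iha => intro σ ξ h; exact ihf σ ξ h _ _ (iha σ ξ h)
  | @lam Γ A B t ih =>
    intro σ ξ h u a hu
    refine Realizes.of_eqB (EqB.beta _ u) ?_
    rw [subst_subst]
    refine ih _ (fun i => Fin.cases a ξ i) (fun i => ?_)
    refine Fin.cases hu (fun i => ?_) i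
    have key : ((σ i).rename (RenB.up [] A)).subst (SbB.single u) = σ i :=
      (rename_subst (σ i) _ _).trans (subst_var (σ i))
    exact key.symm ▸ h i
  | tt => intro σ ξ h; exact EqB.refl
  | ff => intro σ ξ h; exact EqB.refl
  | ite b t u ihb iht ihu =>
    intro σ ξ h
    have hb : EqB (b.subst σ) (ofBool (b.sem ξ)) := ihb σ ξ h
    simp only [subst, sem]
    generalize b.sem ξ = v at hb
    cases v with
    | true => exact (iht σ ξ h).of_eqB ((hb.congIte EqB.refl EqB.refl).trans (EqB.iteTrue _ _))
    | false => exact (ihu σ ξ h).of_eqB ((hb.congIte EqB.refl EqB.refl).trans (EqB.iteFalse _ _))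

/-- A closed boolean term is convertible to the constant it denotes. -/
theorem eqB_ofBool_sem (t : TmB [] Ty.base) : EqB t (ofBool (t.sem (fun i => Fin.elim0 i))) := by
  have h := realizes_subst_sem t (fun i => TmB.var i) (fun i => Fin.elim0 i) (fun i => Fin.elim0 i)
  rwa [subst_var] at h

end TmB

/-- Adequacy of the set-theoretic model of the STLC with booleans: closed terms of base type
with equal interpretations are βη-equal. -/
theorem adequacy (t t' : TmB [] Ty.base)
    (h : t.sem (fun i => Fin.elim0 i) = t'.sem (fun i => Fin.elim0 i)) : EqB t t' := by
  have ht := t.eqB_ofBool_sem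
  rw [h] at ht
  exact ht.trans t'.eqB_ofBool_sem.symm
end
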